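/- Let G be a cyclically 4-edge-connected cubic graph and E(A,B) a cyclic 4-edge-cut of G with cut edges e₁, e₂, e₃, e₄ having end-vertices v₁, v₂, v₃, v₄ in A. For i ∈ {2,3,4}, let G_{(1i)} be the cubic graph obtained from G[A] by adding two new adjacent vertices, one joined to v₁ and v_i, the other joined to the remaining two vertices among v₂, v₃, v₄. Then all three graphs G_{(12)}, G_{(13)}, G_{(14)} are 3-edge-connected, and none of the edges joining v_i to a new vertex lies in a cyclic 3-edge-cut; moreover, if G[A] is not a cycle of length four, then at least two of these three graphs are cyclically 4-edge-connected. -/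

import Mathlib

open SimpleGraph
open scoped Classical

universe u

variable {V : Type u}

/-- `M` is a perfect matching of `G`: a set of edges of `G` such that every
vertex is incident to exactly one edge of `M`. -/
def IsPM (G : SimpleGraph V) (M : Set (Sym2 V)) : Prop :=
  M ⊆ G.edgeSet ∧ ∀ v : V, ∃! e, e ∈ M ∧ v ∈ e

/-- The edge-cut `E(A, Aᶜ)`: edges of `G` with one end in `A` and one end outside. -/
def cutEdges (G : SimpleGraph V) (A : Set V) : Set (Sym2 V) :=
  {e | e ∈ G.edgeSet ∧ ∃ x y, e = s(x, y) ∧ x ∈ A ∧ y ∉ A}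

/-- The edge-cut `E(A, Aᶜ)` is cyclic: both sides induce a subgraph with a cycle. -/
def CyclicCut (G : SimpleGraph V) (A : Set V) : Prop :=
  ¬(G.induce A).IsAcyclic ∧ ¬(G.induce Aᶜ).IsAcyclic

/-- `G` has no cyclic edge-cut of size less than `k`. -/
def CyclicallyEdgeConnected (G : SimpleGraph V) (k : ℕ) : Prop :=
  ∀ A : Set V, CyclicCut G A → k ≤ (cutEdges G A).ncard

/-- Every edge-cut of `G` has at least `k` edges. -/
def EdgeConnectedGe (G : SimpleGraph V) (k : ℕ) : Prop :=
  ∀ A : Set V, A.Nonempty → Aᶜ.Nonempty → k ≤ (cutEdges G A).ncard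

/-- `G` is cubic: every vertex has degree three. -/
def CubicGraph (G : SimpleGraph V) : Prop :=
  ∀ v : V, (G.neighborSet v).ncard = 3

/-- `G` has no bridges. -/
def Bridgeless (G : SimpleGraph V) : Prop :=
  ∀ e ∈ G.edgeSet, ¬G.IsBridge e

/-- `G` is matching-covered: connected and every edge lies in a perfect matching. -/
def MatchingCovered (G : SimpleGraph V) : Prop :=
  G.Connected ∧ ∀ e ∈ G.edgeSet, ∃ M, IsPM G M ∧ e ∈ M

/-- `M` is a matching of the subgraph of `G` induced on `A` which covers exactly the
vertices of `A \ X` (i.e. covers all vertices of `A` except those in `X`). -/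
def IsNearPM (G : SimpleGraph V) (A X : Set V) (M : Set (Sym2 V)) : Prop :=
  (∀ e ∈ M, ∃ x y, e = s(x, y) ∧ G.Adj x y ∧ x ∈ A ∧ y ∈ A) ∧
  (∀ w ∈ A \ X, ∃! e, e ∈ M ∧ w ∈ e) ∧
  (∀ w ∈ X, ∀ e ∈ M, w ∉ e)

/-- `IsTwistedNet G st c`: the subgraph of `G` induced on the vertex set `st` is a
twisted net with corner set `c`.  A 4-cycle is a twisted net whose corners are its
four vertices; and one may join a twisted net and a twisted net (multiplication), or
a twisted net and a single edge (incrementation), by two edges between corners. -/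
inductive IsTwistedNet (G : SimpleGraph V) : Set V → Set V → Prop
  | cyc4 (a b c d : V) (hab : a ≠ b) (hac : a ≠ c) (had : a ≠ d)
      (hbc : b ≠ c) (hbd : b ≠ d) (hcd : c ≠ d)
      (hadj : ∀ x ∈ ({a, b, c, d} : Set V), ∀ y ∈ ({a, b, c, d} : Set V),
        (G.Adj x y ↔ s(x, y) ∈ ({s(a, b), s(b, c), s(c, d), s(d, a)} : Set (Sym2 V)))) :
      IsTwistedNet G {a, b, c, d} {a, b, c, d}
  | incr (st c : Set V) (u u' v v' : V)
      (hprev : IsTwistedNet G st c)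
      (hu : u ∈ c) (hu' : u' ∈ c) (huu' : u ≠ u')
      (hv : v ∉ st) (hv' : v' ∉ st) (hvv' : v ≠ v')
      (hvv'adj : G.Adj v v') (huv : G.Adj u v) (hu'v' : G.Adj u' v')
      (hcross : ∀ x ∈ st, (G.Adj x v ↔ x = u) ∧ (G.Adj x v' ↔ x = u')) :
      IsTwistedNet G (st ∪ {v, v'}) ((c \ {u, u'}) ∪ {v, v'})
  | mult (st₁ c₁ st₂ c₂ : Set V) (u u' v v' : V)
      (h₁ : IsTwistedNet G st₁ c₁) (h₂ : IsTwistedNet G st₂ c₂)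
      (hdisj : st₁ ∩ st₂ = ∅)
      (hu : u ∈ c₁) (hu' : u' ∈ c₁) (huu' : u ≠ u')
      (hv : v ∈ c₂) (hv' : v' ∈ c₂) (hvv' : v ≠ v')
      (huv : G.Adj u v) (hu'v' : G.Adj u' v')
      (hcross : ∀ x ∈ st₁, ∀ y ∈ st₂,
        (G.Adj x y ↔ ((x = u ∧ y = v) ∨ (x = u' ∧ y = v')))) :
      IsTwistedNet G (st₁ ∪ st₂) ((c₁ \ {u, u'}) ∪ (c₂ \ {v, v'}))

/-- The set of (vertex sets of) semiblocks of `G`: inclusion-wise minimal sides of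
2-edge-cuts. -/
def Semiblocks (G : SimpleGraph V) : Set (Set V) :=
  {A | A.Nonempty ∧ (cutEdges G A).ncard = 2 ∧
    ∀ A' ⊆ A, A'.Nonempty → (cutEdges G A').ncard = 2 → A' = A}

/-- The number of semiblocks of `G`; if `G` has no 2-edge-cut, `G` itself is its
unique semiblock, so the number of semiblocks is `1` in this case. -/
noncomputable def numSemiblocks (G : SimpleGraph V) : ℕ :=
  max 1 (Semiblocks G).ncard

/-- The side `B` of a cyclic 4-edge-cut is solid if `G[B]` has no 2-edge-cut with at
least two vertices on each side. -/
def SolidSide (G : SimpleGraph V) (B : Set V) : Prop :=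
  ¬∃ X ⊆ B, 2 ≤ X.ncard ∧ 2 ≤ (B \ X).ncard ∧
      ({e | e ∈ G.edgeSet ∧ ∃ x y, e = s(x, y) ∧ x ∈ X ∧ y ∈ B \ X}).ncard = 2

/-- The subgraph of `G` induced on `A` is a ladder (a `2 × k` grid) whose two ends
(the edges both of whose end-vertices have degree two in the ladder) are `f₁` and `f₂`. -/
def IsLadder (G : SimpleGraph V) (A : Set V) (f₁ f₂ : Sym2 V) : Prop :=
  ∃ (k : ℕ) (x y : Fin (k + 1) → V),
    Function.Injective x ∧ Function.Injective y ∧ (∀ i j, x i ≠ y j) ∧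
    A = Set.range x ∪ Set.range y ∧
    (∀ u ∈ A, ∀ v ∈ A, (G.Adj u v ↔
      ((∃ i, u = x i ∧ v = y i) ∨ (∃ i, u = y i ∧ v = x i) ∨
       (∃ i : Fin k, (u = x i.castSucc ∧ v = x i.succ) ∨ (u = x i.succ ∧ v = x i.castSucc) ∨
         (u = y i.castSucc ∧ v = y i.succ) ∨ (u = y i.succ ∧ v = y i.castSucc))))) ∧
    f₁ = s(x 0, y 0) ∧ f₂ = s(x (Fin.last k), y (Fin.last k))

/-- The subgraph of `G` induced on `A` is a cycle of length four. -/
def Is4Cycle (G : SimpleGraph V) (A : Set V) : Prop :=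
  ∃ a b c d : V, a ≠ b ∧ a ≠ c ∧ a ≠ d ∧ b ≠ c ∧ b ≠ d ∧ c ≠ d ∧
    A = {a, b, c, d} ∧
    G.Adj a b ∧ G.Adj b c ∧ G.Adj c d ∧ G.Adj d a ∧ ¬G.Adj a c ∧ ¬G.Adj b d

/-- The graph `G_{(pq)}` obtained from `G[A]` by adding a new vertex (`Sum.inr 0`)
adjacent to `p` and `q`, a new vertex (`Sum.inr 1`) adjacent to `r` and `t`, and an
edge between the two new vertices. -/
def GExt (G : SimpleGraph V) (A : Set V) (p q r t : V) : SimpleGraph (↥A ⊕ Fin 2) :=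
  SimpleGraph.fromRel (fun x y =>
    (∃ u v : A, x = Sum.inl u ∧ y = Sum.inl v ∧ G.Adj u v) ∨
    (∃ u : A, x = Sum.inr 0 ∧ y = Sum.inl u ∧ ((u : V) = p ∨ (u : V) = q)) ∨
    (∃ u : A, x = Sum.inr 1 ∧ y = Sum.inl u ∧ ((u : V) = r ∨ (u : V) = t)) ∨
    (x = Sum.inr 0 ∧ y = Sum.inr 1))

/-- Perfect matching, as a finite edge set. -/
def IsPMF (G : SimpleGraph V) (M : Finset (Sym2 V)) : Prop :=
  (↑M : Set (Sym2 V)) ⊆ G.edgeSet ∧ ∀ v : V, ∃! e, e ∈ M ∧ v ∈ e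

/-- `w` lies in the perfect matching polytope of `G`: it is a convex combination of
characteristic vectors of perfect matchings of `G`. -/
def InPMPolytope [Fintype V] [DecidableEq V] (G : SimpleGraph V) (w : Sym2 V → ℝ) : Prop :=
  ∃ μ : Finset (Sym2 V) → ℝ,
    (∀ M, 0 ≤ μ M) ∧ (∀ M, μ M ≠ 0 → IsPMF G M) ∧
    (∑ M : Finset (Sym2 V), μ M) = 1 ∧
    ∀ e : Sym2 V, w e = ∑ M : Finset (Sym2 V), μ M * (if e ∈ M then 1 else 0)

/-- A graph containing a cycle contains a finite vertex set inducing a cycle. -/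
lemma exists_finite_not_isAcyclic_induce {G : SimpleGraph V} {A : Set V}
    (h : ¬(G.induce A).IsAcyclic) :
    ∃ S ⊆ A, S.Finite ∧ ¬(G.induce S).IsAcyclic := by
  simp only [SimpleGraph.IsAcyclic, not_forall, not_not] at h
  obtain ⟨v, c, hc⟩ := h
  let c' := c.map (Embedding.induce (G := G) A).toHom
  have hc' : c'.IsCycle := hc.map (Embedding.induce (G := G) A).injective
  obtain ⟨S, hS⟩ : ∃ S : Set V, ∀ x, x ∈ S ↔ x ∈ c'.support :=
    ⟨{x | x ∈ c'.support}, fun _ => Iff.rfl⟩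
  refine ⟨S, ?_, (List.finite_toSet c'.support).subset fun x hx => (hS x).1 hx, fun hac => ?_⟩
  · intro x hx
    simp only [hS, c', Walk.support_map, List.mem_map] at hx
    obtain ⟨y, -, rfl⟩ := hx
    exact y.2
  · refine hac (c'.induce S fun x hx => (hS x).2 hx) (Walk.IsCycle.of_map
      (f := (Embedding.induce (G := G) S).toHom) ?_)
    rw [Walk.map_induce]
    exact hc'

lemma not_isAcyclic_induce_mono {G : SimpleGraph V} {S T : Set V} (hST : S ⊆ T)
    (h : ¬(G.induce S).IsAcyclic) : ¬(G.induce T).IsAcyclic :=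
  fun hT => h (hT.embedding (G.induceHomOfLE hST))

lemma cyclicCut_mono {G : SimpleGraph V} {S T X : Set V} (hS : ¬(G.induce S).IsAcyclic)
    (hT : ¬(G.induce T).IsAcyclic) (hSX : S ⊆ X) (hTX : T ⊆ Xᶜ) : CyclicCut G X :=
  ⟨not_isAcyclic_induce_mono hSX hS, not_isAcyclic_induce_mono hTX hT⟩

lemma not_subsingleton_of_not_isAcyclic {G : SimpleGraph V} {S : Set V}
    (h : ¬(G.induce S).IsAcyclic) : ¬S.Subsingleton := fun hS => by
  have : Subsingleton S := hS.coe_sort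
  exact h IsAcyclic.of_subsingleton

lemma CubicGraph.finite_neighborSet {G : SimpleGraph V} (hG : CubicGraph G) (v : V) :
    (G.neighborSet v).Finite :=
  Set.finite_of_ncard_ne_zero (by rw [hG v]; norm_num)

/-- In an infinite graph of finite degrees, there is an infinite independent set avoiding a given
finite set. -/
lemma exists_infinite_indep [Infinite V] {G : SimpleGraph V}
    (hG : ∀ v, (G.neighborSet v).Finite) {F : Set V} (hF : F.Finite) :
    ∃ I : Set V, I.Infinite ∧ Disjoint I F ∧ ∀ x ∈ I, ∀ y ∈ I, ¬G.Adj x y := by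
  obtain ⟨I, hI⟩ := zorn_subset {I : Set V | Disjoint I F ∧ ∀ x ∈ I, ∀ y ∈ I, ¬G.Adj x y} (by
    intro c hc hchain
    refine ⟨⋃₀ c, ⟨Set.disjoint_sUnion_left.2 fun s hs => (hc hs).1, ?_⟩,
      fun s hs => Set.subset_sUnion_of_mem hs⟩
    rintro x ⟨s, hs, hx⟩ y ⟨t, ht, hy⟩
    rcases hchain.total hs ht with h | h
    · exact (hc ht).2 x (h hx) y hy
    · exact (hc hs).2 x hx y (h hy))
  refine ⟨I, fun hfin => ?_, hI.prop.1, hI.prop.2⟩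
  have hfin' : (F ∪ I ∪ ⋃ x ∈ I, G.neighborSet x).Finite :=
    (hF.union hfin).union (hfin.biUnion fun x _ => hG x)
  obtain ⟨v, hv⟩ := hfin'.exists_notMem
  simp only [Set.mem_union, Set.mem_iUnion, mem_neighborSet, not_or, not_exists] at hv
  have hmem : insert v I ∈ {I : Set V | Disjoint I F ∧ ∀ x ∈ I, ∀ y ∈ I, ¬G.Adj x y} := by
    refine ⟨Set.disjoint_insert_left.2 ⟨hv.1.1, hI.prop.1⟩, ?_⟩
    rintro x (rfl | hx) y (rfl | hy)
    · exact G.loopless.irrefl _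
    · exact fun h => hv.2 y hy h.symm
    · exact fun h => hv.2 x hx h
    · exact hI.prop.2 x hx y hy
  exact hv.1.2 (hI.le_of_ge hmem (Set.subset_insert v I) (Set.mem_insert v I))

/-- A cubic graph with two disjoint cycles in which every cyclic edge-cut has positive
cardinality `Set.ncard`, and hence is finite, is a finite graph. -/
lemma finite_of_cyclicallyEdgeConnected {G : SimpleGraph V} (hG : CubicGraph G) {k : ℕ}
    (hk : 0 < k) (hC : CyclicallyEdgeConnected G k) {A : Set V} (hA : CyclicCut G A) :
    Finite V := by
  by_contra hinf
  rw [not_finite_iff_infinite] at hinf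
  obtain ⟨S, hSA, hSf, hS⟩ := exists_finite_not_isAcyclic_induce hA.1
  obtain ⟨T, hTA, hTf, hT⟩ := exists_finite_not_isAcyclic_induce hA.2
  obtain ⟨I, hI, hdisj, hind⟩ := exists_infinite_indep hG.finite_neighborSet
    ((hSf.union hTf).union (hSf.biUnion fun x _ => hG.finite_neighborSet x))
  have hIF : ∀ x ∈ I, x ∉ S ∧ x ∉ T ∧ ∀ y ∈ S, ¬G.Adj y x := by
    intro x hx
    have := Set.disjoint_left.1 hdisj hx
    simpa [not_or, and_assoc] using this
  have hcyc : CyclicCut G (S ∪ I) := by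
    refine cyclicCut_mono hS hT Set.subset_union_left fun x hx hx' => ?_
    rcases hx' with h | h
    · exact hTA hx (hSA h)
    · exact (hIF x h).2.1 hx
  have hpos : 0 < (cutEdges G (S ∪ I)).ncard := hk.trans_le (hC _ hcyc)
  have hfin := Set.finite_of_ncard_pos hpos
  have hnb : ∀ x : V, ∃ y, G.Adj x y := fun x => by
    obtain ⟨y, hy⟩ := Set.nonempty_of_ncard_ne_zero (s := G.neighborSet x) (by rw [hG x]; norm_num)
    exact ⟨y, hy⟩
  choose f hf using hnb
  refine hI (Set.Finite.subset (hfin.biUnion (t := fun e => {v | v ∈ e}) fun e _ => ?_)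
    fun x hx => ?_)
  · exact Sym2.ind (fun a b => (Set.toFinite {a, b}).subset fun v hv => by simpa using hv) e
  refine Set.mem_biUnion (x := s(x, f x)) ⟨hf x, x, f x, rfl, Or.inr hx, ?_⟩ (Sym2.mem_mk_left _ _)
  rintro (h | h)
  · exact (hIF x hx).2.2 _ h (hf x).symm
  · exact hind x hx _ h (hf x)

/-- The number of ordered pairs of adjacent vertices, the first in `S` and the second in `T`. -/
noncomputable def pairCount [Fintype V] (G : SimpleGraph V) (S T : Set V) : ℕ :=
  ∑ x, ∑ y, if x ∈ S ∧ y ∈ T ∧ G.Adj x y then 1 else 0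

section pairCount

variable [Fintype V] (G : SimpleGraph V)

lemma pairCount_eq_ncard (S T : Set V) :
    pairCount G S T = {p : V × V | p.1 ∈ S ∧ p.2 ∈ T ∧ G.Adj p.1 p.2}.ncard := by
  rw [Set.ncard_eq_toFinset_card', pairCount, ← Fintype.sum_prod_type', ← Finset.sum_filter,
    ← Finset.card_eq_sum_ones]
  congr 1
  ext
  simp

lemma pairCount_comm (S T : Set V) : pairCount G S T = pairCount G T S := by
  unfold pairCount
  rw [Finset.sum_comm]
  refine Finset.sum_congr rfl fun x _ => Finset.sum_congr rfl fun y _ => ?_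
  simp only [G.adj_comm x y]
  exact if_congr (by tauto) rfl rfl

lemma pairCount_union_left {S S' : Set V} (h : Disjoint S S') (T : Set V) :
    pairCount G (S ∪ S') T = pairCount G S T + pairCount G S' T := by
  simp only [pairCount, ← Finset.sum_add_distrib]
  refine Finset.sum_congr rfl fun x _ => Finset.sum_congr rfl fun y _ => ?_
  have := fun hx : x ∈ S => Set.disjoint_left.1 h hx
  by_cases h1 : x ∈ S <;> by_cases h2 : x ∈ S' <;> simp_all

lemma pairCount_union_right {T T' : Set V} (h : Disjoint T T') (S : Set V) :
    pairCount G S (T ∪ T') = pairCount G S T + pairCount G S T' := by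
  rw [pairCount_comm, pairCount_union_left G h, pairCount_comm G T, pairCount_comm G T']

lemma ncard_cutEdges (S : Set V) : (cutEdges G S).ncard = pairCount G S Sᶜ := by
  have himg : cutEdges G S =
      (fun p : V × V => s(p.1, p.2)) '' {p | p.1 ∈ S ∧ p.2 ∈ Sᶜ ∧ G.Adj p.1 p.2} := by
    ext e
    constructor
    · rintro ⟨he, x, y, rfl, hx, hy⟩
      exact ⟨(x, y), ⟨hx, hy, he⟩, rfl⟩
    · rintro ⟨⟨x, y⟩, ⟨hx, hy, he⟩, rfl⟩
      exact ⟨he, x, y, rfl, hx, hy⟩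
  rw [himg, Set.InjOn.ncard_image, pairCount_eq_ncard]
  · rintro ⟨x, y⟩ ⟨hx, hy, -⟩ ⟨x', y'⟩ ⟨hx', hy', -⟩ h
    rcases Sym2.eq_iff.1 h with ⟨h1, h2⟩ | ⟨h1, h2⟩
    · exact Prod.ext h1 h2
    · exact absurd hx (by simp only at h1; rw [h1]; exact hy')

lemma pairCount_compl (S : Set V) : pairCount G Sᶜ Sᶜᶜ = pairCount G S Sᶜ := by
  rw [compl_compl, pairCount_comm]

lemma pairCount_univ {G : SimpleGraph V} (hG : CubicGraph G) (S : Set V) :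
    pairCount G S Set.univ = 3 * S.ncard := by
  have h : ∀ x, (∑ y, if x ∈ S ∧ y ∈ Set.univ ∧ G.Adj x y then 1 else 0)
      = if x ∈ S then 3 else 0 := by
    intro x
    by_cases hx : x ∈ S
    · rw [if_pos hx, ← hG x, Set.ncard_eq_toFinset_card', Finset.sum_boole]
      simp only [hx, true_and, Set.mem_univ, Nat.cast_id]
      congr 1
      ext y
      simp
    · simp [hx]
  trans ∑ x, if x ∈ S then 3 else 0
  · exact Finset.sum_congr rfl fun x _ => by convert h x
  rw [← Finset.sum_filter, Finset.sum_const, Set.ncard_eq_toFinset_card', smul_eq_mul, mul_comm]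
  congr 2
  ext
  simp

lemma two_mul_ncard_edgeSet_induce (S : Set V) :
    2 * (G.induce S).edgeSet.ncard = pairCount G S S := by
  rw [Set.ncard_eq_toFinset_card']
  change 2 * (G.induce S).edgeFinset.card = _
  rw [two_mul_card_edgeFinset, pairCount, ← Fintype.sum_prod_type', ← Finset.sum_filter,
    ← Finset.card_eq_sum_ones]
  refine Finset.card_bij (fun p _ => ((p.1 : V), (p.2 : V))) ?_ ?_ ?_
  · rintro ⟨x, y⟩ h
    simpa using h
  · rintro ⟨x, y⟩ - ⟨x', y'⟩ - h
    simpa [Subtype.ext_iff] using h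
  · rintro ⟨x, y⟩ h
    simp only [Finset.mem_filter, Finset.mem_univ, true_and] at h
    exact ⟨(⟨x, h.1⟩, ⟨y, h.2.1⟩), by simpa using h.2.2, rfl⟩

lemma ncard_edgeSet_lt_of_isAcyclic {W : Type*} [Finite W] [Nonempty W] {F : SimpleGraph W}
    (hF : F.IsAcyclic) : F.edgeSet.ncard + 1 ≤ Nat.card W := by
  obtain ⟨T, hFT, -, hT⟩ := connected_top.exists_isTree_le_of_le_of_isAcyclic le_top hF
  rw [← (isTree_iff_connected_and_card.1 hT).2, Nat.card_coe_set_eq]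
  exact Nat.succ_le_succ (Set.ncard_le_ncard (edgeSet_mono hFT))

/-- In a cubic graph, a nonempty set of vertices inducing a forest has a large edge boundary. -/
lemma ncard_add_two_le_of_isAcyclic {G : SimpleGraph V} (hG : CubicGraph G) {S : Set V}
    (hS : S.Nonempty) (hac : (G.induce S).IsAcyclic) :
    S.ncard + 2 ≤ pairCount G S Sᶜ := by
  have : Nonempty S := hS.to_subtype
  have h1 := pairCount_univ hG S
  rw [← Set.union_compl_self S, pairCount_union_right G disjoint_compl_right,
    ← two_mul_ncard_edgeSet_induce] at h1
  have h2 := ncard_edgeSet_lt_of_isAcyclic hac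
  rw [Nat.card_coe_set_eq] at h2
  omega

/-- The edge boundary of a proper nonempty vertex set of a cyclically 4-edge-connected cubic graph
has at least four edges, unless it isolates a single vertex. -/
lemma three_le_pairCount_compl {G : SimpleGraph V} (hG : CubicGraph G)
    (hC : CyclicallyEdgeConnected G 4) {S : Set V} (hS : S.Nonempty) (hS' : Sᶜ.Nonempty) :
    3 ≤ pairCount G S Sᶜ ∧ (pairCount G S Sᶜ ≤ 3 → S.Subsingleton ∨ Sᶜ.Subsingleton) := by
  by_cases h4 : 4 ≤ pairCount G S Sᶜ
  · exact ⟨by omega, fun h => by omega⟩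
  have hnc : ¬CyclicCut G S := fun h => h4 (by simpa [ncard_cutEdges] using hC S h)
  rw [CyclicCut, not_and_or, not_not, not_not] at hnc
  have hp := (Set.ncard_pos (Set.toFinite S)).2 hS
  have hp' := (Set.ncard_pos (Set.toFinite Sᶜ)).2 hS'
  rcases hnc with h | h
  · have := ncard_add_two_le_of_isAcyclic hG hS h
    exact ⟨by omega, fun _ => Or.inl (Set.ncard_le_one_iff_subsingleton.1 (by omega))⟩
  · have := ncard_add_two_le_of_isAcyclic hG hS' h
    rw [pairCount_compl] at this
    exact ⟨by omega, fun _ => Or.inr (Set.ncard_le_one_iff_subsingleton.1 (by omega))⟩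

end pairCount

/-- The truth value of a proposition as a natural number, `1` if it holds and `0` otherwise. -/
noncomputable def truthVal (P : Prop) : ℕ := if P then 1 else 0

lemma truthVal_of_pos {P : Prop} (h : P) : truthVal P = 1 := if_pos h

lemma truthVal_of_neg {P : Prop} (h : ¬P) : truthVal P = 0 := if_neg h

lemma pairCount_eq_sum_truthVal [Fintype V] (G : SimpleGraph V) (S T : Set V) :
    pairCount G S T = ∑ x, ∑ y, truthVal (x ∈ S ∧ y ∈ T ∧ G.Adj x y) := by
  exact Finset.sum_congr rfl fun x _ => Finset.sum_congr rfl fun y _ => by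
    rw [truthVal]
    congr

section extension

variable [Fintype V] {G : SimpleGraph V} {A : Set V} {p q r t : V}

/-- If four cut edges leave `A` from distinct vertices `p, q, r, t`, then the number of cut edges
leaving a subset of `A` counts how many of these vertices it contains. -/
lemma pairCount_compl_of_cutEdges_eq {p' q' r' t' : V}
    (hpq : p ≠ q) (hpr : p ≠ r) (hpt : p ≠ t) (hqr : q ≠ r) (hqt : q ≠ t) (hrt : r ≠ t)
    (hA : p ∈ A ∧ q ∈ A ∧ r ∈ A ∧ t ∈ A) (hA' : p' ∉ A ∧ q' ∉ A ∧ r' ∉ A ∧ t' ∉ A)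
    (hcut : cutEdges G A = {s(p, p'), s(q, q'), s(r, r'), s(t, t')}) {X : Set V} (hX : X ⊆ A) :
    pairCount G X Aᶜ =
      truthVal (p ∈ X) + truthVal (q ∈ X) + truthVal (r ∈ X) + truthVal (t ∈ X) := by
  have hadj : ∀ x ∈ A, ∀ y ∉ A, (G.Adj x y ↔
      (x = p ∧ y = p') ∨ (x = q ∧ y = q') ∨ (x = r ∧ y = r') ∨ (x = t ∧ y = t')) := by
    intro x hx y hy
    have h1 : G.Adj x y ↔ s(x, y) ∈ cutEdges G A :=
      ⟨fun h => ⟨h, x, y, rfl, hx, hy⟩, fun h => h.1⟩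
    rw [h1, hcut]
    simp only [Set.mem_insert_iff, Set.mem_singleton_iff, Sym2.eq_iff]
    grind
  have hsum : ∀ a a' : V,
      truthVal (a ∈ X) = ∑ x, ∑ y, if x ∈ X ∧ x = a ∧ y = a' then 1 else 0 := by
    intro a a'
    rw [Finset.sum_eq_single a (fun b _ hb => by simp [hb]) (by simp),
      Finset.sum_eq_single a' (fun b _ hb => by simp [hb]) (by simp)]
    simp [truthVal]
  rw [hsum p p', hsum q q', hsum r r', hsum t t']
  simp only [pairCount, ← Finset.sum_add_distrib]
  refine Finset.sum_congr rfl fun x _ => Finset.sum_congr rfl fun y _ => ?_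
  by_cases hx : x ∈ X
  · by_cases hy : y ∈ A
    · grind
    · have := hadj x (hX hx) y hy
      grind
  · simp [hx]

lemma sum_subtype_eq_sum (A : Set V) {f : V → ℕ} (hf : ∀ x ∉ A, f x = 0) :
    ∑ a : A, f a = ∑ x, f x := by
  rw [← Finset.sum_subtype (p := (· ∈ A)) (Finset.univ.filter (· ∈ A)) (by simp) f,
    Finset.sum_filter_of_ne fun x _ hx => by_contra fun h => hx (hf x h)]

lemma sum_subtype_truthVal (hpq : p ≠ q) (hp : p ∈ A) (hq : q ∈ A) (P : V → Prop) {Q : A → Prop}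
    (hQ : ∀ a : A, Q a ↔ P a ∧ ((a : V) = p ∨ (a : V) = q)) :
    ∑ a : A, truthVal (Q a) = truthVal (P p) + truthVal (P q) := by
  have h : ∀ a : A, truthVal (Q a) =
      (if (⟨p, hp⟩ : A) = a then truthVal (P p) else 0) +
      (if (⟨q, hq⟩ : A) = a then truthVal (P q) else 0) := by
    intro a
    simp only [hQ, Subtype.ext_iff, truthVal]
    grind
  rw [Finset.sum_congr rfl fun a _ => h a, Finset.sum_add_distrib, Finset.sum_ite_eq,
    Finset.sum_ite_eq]
  simp

section adj

variable {W : Type*} {G : SimpleGraph W} {A : Set W} {p q r t : W}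

lemma gExt_adj_inl_inl (a b : A) :
    (GExt G A p q r t).Adj (Sum.inl a) (Sum.inl b) ↔ G.Adj a b := by
  simp only [GExt, fromRel_adj]
  have := G.ne_of_adj (a := (a : W)) (b := b)
  have := G.adj_comm a b
  simp
  grind

lemma gExt_adj_inr_zero_inl (a : A) :
    (GExt G A p q r t).Adj (Sum.inr 0) (Sum.inl a) ↔ (a : W) = p ∨ (a : W) = q := by
  simp [GExt]

lemma gExt_adj_inr_one_inl (a : A) :
    (GExt G A p q r t).Adj (Sum.inr 1) (Sum.inl a) ↔ (a : W) = r ∨ (a : W) = t := by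
  simp [GExt]

lemma gExt_adj_inl_inr_zero (a : A) :
    (GExt G A p q r t).Adj (Sum.inl a) (Sum.inr 0) ↔ (a : W) = p ∨ (a : W) = q := by
  rw [adj_comm, gExt_adj_inr_zero_inl]

lemma gExt_adj_inl_inr_one (a : A) :
    (GExt G A p q r t).Adj (Sum.inl a) (Sum.inr 1) ↔ (a : W) = r ∨ (a : W) = t := by
  rw [adj_comm, gExt_adj_inr_one_inl]

lemma gExt_adj_inr_inr (i j : Fin 2) :
    (GExt G A p q r t).Adj (Sum.inr i) (Sum.inr j) ↔ i ≠ j := by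
  fin_cases i <;> fin_cases j <;> simp [GExt]

end adj

lemma sum_inl_eq_pairCount {Z Z' : Set (↥A ⊕ Fin 2)} {X X' : Set V}
    (hX : ∀ a : A, Sum.inl a ∈ Z ↔ (a : V) ∈ X) (hX' : ∀ a : A, Sum.inl a ∈ Z' ↔ (a : V) ∈ X')
    (hXA : X ⊆ A) (hXA' : X' ⊆ A) :
    ∑ a : A, ∑ b : A, truthVal ((Sum.inl a : A ⊕ Fin 2) ∈ Z ∧ (Sum.inl b : A ⊕ Fin 2) ∈ Z' ∧
      (GExt G A p q r t).Adj (Sum.inl a) (Sum.inl b)) = pairCount G X X' := by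
  rw [pairCount_eq_sum_truthVal, ← sum_subtype_eq_sum A fun x hx => by
    simp [show x ∉ X from fun h => hx (hXA h), truthVal]]
  refine Finset.sum_congr rfl fun a _ => ?_
  rw [← sum_subtype_eq_sum A fun x hx => by
    simp [show x ∉ X' from fun h => hx (hXA' h), truthVal]]
  exact Finset.sum_congr rfl fun b _ => by simp [hX, hX', gExt_adj_inl_inl]

/-- The boundary of a set of vertices of an extension graph, in terms of the boundary inside `A` of
its trace on `A`. -/
lemma pairCount_gExt (hpq : p ≠ q) (hrt : r ≠ t)
    (hA : p ∈ A ∧ q ∈ A ∧ r ∈ A ∧ t ∈ A) {Z : Set (↥A ⊕ Fin 2)} {X : Set V}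
    (hX : ∀ a : A, Sum.inl a ∈ Z ↔ (a : V) ∈ X) :
    pairCount (GExt G A p q r t) Z Zᶜ = pairCount G (A ∩ X) (A \ X) +
      truthVal (¬(Sum.inr 0 ∈ Z ↔ p ∈ X)) + truthVal (¬(Sum.inr 0 ∈ Z ↔ q ∈ X)) +
      truthVal (¬(Sum.inr 1 ∈ Z ↔ r ∈ X)) + truthVal (¬(Sum.inr 1 ∈ Z ↔ t ∈ X)) +
      truthVal (¬(Sum.inr 0 ∈ Z ↔ Sum.inr 1 ∈ Z)) := by
  rw [pairCount_eq_sum_truthVal]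
  simp only [Fintype.sum_sum_type, Fin.sum_univ_two, Finset.sum_add_distrib]
  rw [sum_inl_eq_pairCount (X := A ∩ X) (X' := A \ X) (by simp [hX]) (by simp [hX])
      Set.inter_subset_left Set.sdiff_subset,
    sum_subtype_truthVal hpq hA.1 hA.2.1 (fun x => Sum.inr 0 ∈ Z ∧ x ∉ X)
      (Q := fun a => Sum.inr 0 ∈ Z ∧ Sum.inl a ∈ Zᶜ ∧ _)
      (fun a => by simp [hX, gExt_adj_inr_zero_inl, and_assoc]),
    sum_subtype_truthVal hrt hA.2.2.1 hA.2.2.2 (fun x => Sum.inr 1 ∈ Z ∧ x ∉ X)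
      (Q := fun a => Sum.inr 1 ∈ Z ∧ Sum.inl a ∈ Zᶜ ∧ _)
      (fun a => by simp [hX, gExt_adj_inr_one_inl, and_assoc]),
    sum_subtype_truthVal hpq hA.1 hA.2.1 (fun x => x ∈ X ∧ Sum.inr 0 ∉ Z)
      (Q := fun a => Sum.inl a ∈ Z ∧ Sum.inr 0 ∈ Zᶜ ∧ _)
      (fun a => by simp [hX, gExt_adj_inl_inr_zero, and_assoc]),
    sum_subtype_truthVal hrt hA.2.2.1 hA.2.2.2 (fun x => x ∈ X ∧ Sum.inr 1 ∉ Z)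
      (Q := fun a => Sum.inl a ∈ Z ∧ Sum.inr 1 ∈ Zᶜ ∧ _)
      (fun a => by simp [hX, gExt_adj_inl_inr_one, and_assoc])]
  simp only [gExt_adj_inr_inr, Set.mem_compl_iff, truthVal]
  by_cases h0 : Sum.inr 0 ∈ Z <;> by_cases h1 : Sum.inr 1 ∈ Z <;> by_cases hp : p ∈ X <;>
    by_cases hq : q ∈ X <;> by_cases hr : r ∈ X <;> by_cases ht : t ∈ X <;> simp [*]

end extension

/-- The vertex set `A` contains four distinct vertices `p, q, r, t` each of which sends one further
edge out of `A`; at least three edges leave every nonempty subset of `A`, and more than three if it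
has at least two elements. -/
structure IsFourCutSide [Fintype V] (G : SimpleGraph V) (A : Set V) (p q r t : V) : Prop where
  pq : p ≠ q
  pr : p ≠ r
  pt : p ≠ t
  qr : q ≠ r
  qt : q ≠ t
  rt : r ≠ t
  mem : p ∈ A ∧ q ∈ A ∧ r ∈ A ∧ t ∈ A
  three_le : ∀ X ⊆ A, X.Nonempty → 3 ≤ pairCount G X (A \ X) +
    (truthVal (p ∈ X) + truthVal (q ∈ X) + truthVal (r ∈ X) + truthVal (t ∈ X))
  subsingleton : ∀ X ⊆ A, X.Nonempty → pairCount G X (A \ X) +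
    (truthVal (p ∈ X) + truthVal (q ∈ X) + truthVal (r ∈ X) + truthVal (t ∈ X)) ≤ 3 →
    X.Subsingleton

/-- The vertices `p, q` are separated from `r, t` by a set of two edges of `G[A]`. -/
def IsTwoSeparated [Fintype V] (G : SimpleGraph V) (A : Set V) (p q r t : V) : Prop :=
  ∃ X ⊆ A, p ∈ X ∧ q ∈ X ∧ r ∉ X ∧ t ∉ X ∧ pairCount G X (A \ X) = 2

lemma IsTwoSeparated.swap_last [Fintype V] {G : SimpleGraph V} {A : Set V} {p q r t : V}
    (h : IsTwoSeparated G A p q r t) : IsTwoSeparated G A p q t r := by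
  obtain ⟨X, hXA, hp, hq, hr, ht, hX⟩ := h
  exact ⟨X, hXA, hp, hq, ht, hr, hX⟩

namespace IsFourCutSide

variable [Fintype V] {G : SimpleGraph V} {A : Set V} {p q r t : V}

lemma swap_middle (h : IsFourCutSide G A p q r t) : IsFourCutSide G A p r q t where
  pq := h.pr
  pr := h.pq
  pt := h.pt
  qr := h.qr.symm
  qt := h.rt
  rt := h.qt
  mem := ⟨h.mem.1, h.mem.2.2.1, h.mem.2.1, h.mem.2.2.2⟩
  three_le X hX hX' := by have := h.three_le X hX hX'; omega
  subsingleton X hX hX' hle := h.subsingleton X hX hX' (by omega)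

lemma swap_last (h : IsFourCutSide G A p q r t) : IsFourCutSide G A p q t r where
  pq := h.pq
  pr := h.pt
  pt := h.pr
  qr := h.qt
  qt := h.qr
  rt := h.rt.symm
  mem := ⟨h.mem.1, h.mem.2.1, h.mem.2.2.2, h.mem.2.2.1⟩
  three_le X hX hX' := by have := h.three_le X hX hX'; omega
  subsingleton X hX hX' hle := h.subsingleton X hX hX' (by omega)

lemma two_le_pairCount (h : IsFourCutSide G A p q r t) {X : Set V} (hX : X ⊆ A)
    (hne : X.Nonempty) (hne' : (A \ X).Nonempty) : 2 ≤ pairCount G X (A \ X) := by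
  have h1 := h.three_le X hX hne
  have h2 := h.three_le (A \ X) Set.sdiff_subset hne'
  have h3 := h.subsingleton X hX hne
  have h4 := h.subsingleton (A \ X) Set.sdiff_subset hne'
  rw [Set.sdiff_sdiff_cancel_left hX, pairCount_comm] at h2 h4
  obtain ⟨hp, hq, hr, ht⟩ := h.mem
  simp only [Set.mem_sdiff, hp, hq, hr, ht, true_and] at h2 h4
  have key : ∀ v, truthVal (v ∈ X) + truthVal (v ∉ X) = 1 := by
    intro v
    by_cases hv : v ∈ X <;> simp [hv, truthVal]
  have := key p
  have := key q
  have := key r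
  have := key t
  by_contra hlt
  have hs := h3 (by omega)
  have hs' := h4 (by omega)
  by_cases kp : p ∈ X <;> by_cases kq : q ∈ X <;> by_cases kr : r ∈ X
  all_goals first
    | exact h.pq (hs kp kq)
    | exact h.pr (hs kp kr)
    | exact h.qr (hs kq kr)
    | exact h.pq (hs' ⟨hp, kp⟩ ⟨hq, kq⟩)
    | exact h.pr (hs' ⟨hp, kp⟩ ⟨hr, kr⟩)
    | exact h.qr (hs' ⟨hq, kq⟩ ⟨hr, kr⟩)

lemma three_le_pairCount_gExt_of_notMem (h : IsFourCutSide G A p q r t) {Z : Set (↥A ⊕ Fin 2)}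
    (h0 : Sum.inr 0 ∉ Z) (hZ : Z.Nonempty) :
    3 ≤ pairCount (GExt G A p q r t) Z Zᶜ ∧ (pairCount (GExt G A p q r t) Z Zᶜ ≤ 3 →
      Z.Subsingleton ∨ Zᶜ.Subsingleton ∨ (IsTwoSeparated G A p q r t ∧
        ∀ (u : A) (i : Fin 2), (GExt G A p q r t).Adj (Sum.inl u) (Sum.inr i) →
          (Sum.inl u ∈ Z ↔ Sum.inr i ∈ Z))) := by
  set X : Set V := Subtype.val '' (Sum.inl ⁻¹' Z : Set A) with hXdef
  have hXA : X ⊆ A := by simp [hXdef]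
  have hX : ∀ a : A, Sum.inl a ∈ Z ↔ (a : V) ∈ X := by simp [hXdef]
  have hcount := pairCount_gExt (G := G) h.pq h.rt h.mem hX
  rw [Set.inter_eq_right.2 hXA] at hcount
  obtain ⟨hp, hq, hr, ht⟩ := h.mem
  by_cases h1 : Sum.inr 1 ∈ Z
  · simp only [h0, h1, false_iff, true_iff, not_not, not_true_eq_false] at hcount
    by_cases hne : X.Nonempty
    · by_cases hne' : (A \ X).Nonempty
      · have h2 := h.two_le_pairCount hXA hne hne'
        have ht1 : truthVal (¬False) = 1 := truthVal_of_pos not_false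
        refine ⟨by omega, fun hle => Or.inr <| Or.inr ?_⟩
        have key : ∀ P : Prop, truthVal P = 0 → ¬P := fun P hP hP' => by
          simp [truthVal_of_pos hP'] at hP
        have kp := key (p ∈ X) (by omega)
        have kq := key (q ∈ X) (by omega)
        have kr := not_not.1 (key (r ∉ X) (by omega))
        have kt := not_not.1 (key (t ∉ X) (by omega))
        refine ⟨⟨A \ X, Set.sdiff_subset, ⟨hp, kp⟩, ⟨hq, kq⟩, fun k => k.2 kr, fun k => k.2 kt, ?_⟩,
          ?_⟩
        · rw [Set.sdiff_sdiff_cancel_left hXA, pairCount_comm]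
          omega
        · intro u i hadj
          fin_cases i
          · rcases (gExt_adj_inl_inr_zero u).1 hadj with hu | hu <;> simp [hX, hu, kp, kq, h0]
          · rcases (gExt_adj_inl_inr_one u).1 hadj with hu | hu <;> simp [hX, hu, kr, kt, h1]
      · have hAX : ∀ a : A, Sum.inl a ∈ Z := fun a =>
          (hX a).2 (by_contra fun ha => hne' ⟨a, a.2, ha⟩)
        have hpX := (hX ⟨p, hp⟩).1 (hAX _)
        have hqX := (hX ⟨q, hq⟩).1 (hAX _)
        simp only [hpX, hqX, truthVal_of_pos] at hcount
        refine ⟨by simp [truthVal] at hcount; omega, fun _ => Or.inr <| Or.inl ?_⟩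
        refine Set.subsingleton_of_subset_singleton (a := Sum.inr 0) ?_
        rintro (a | i) hz
        · exact absurd (hAX a) hz
        · fin_cases i
          · rfl
          · exact absurd h1 hz
    · have hAX : ∀ a : A, Sum.inl a ∉ Z := fun a ha => hne ⟨a, (hX a).1 ha⟩
      have hrX : r ∉ X := fun k => hAX _ ((hX ⟨r, hr⟩).2 k)
      have htX : t ∉ X := fun k => hAX _ ((hX ⟨t, ht⟩).2 k)
      simp only [hrX, htX] at hcount
      refine ⟨by simp [truthVal] at hcount; omega, fun _ => Or.inl ?_⟩
      refine Set.subsingleton_of_subset_singleton (a := Sum.inr 1) ?_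
      rintro (a | i) hz
      · exact absurd hz (hAX a)
      · fin_cases i
        · exact absurd hz h0
        · rfl
  · have hmem : ∀ z ∈ Z, ∃ a : A, z = Sum.inl a := by
      rintro (a | i) hz
      · exact ⟨a, rfl⟩
      · fin_cases i
        · exact absurd hz h0
        · exact absurd hz h1
    have hne : X.Nonempty := by
      obtain ⟨z, hz⟩ := hZ
      obtain ⟨a, rfl⟩ := hmem z hz
      exact ⟨a, (hX a).1 hz⟩
    have h2 := h.three_le X hXA hne
    have h3 := h.subsingleton X hXA hne
    simp only [h0, h1, false_iff, not_not, not_true_eq_false, truthVal_of_neg not_false]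
      at hcount
    refine ⟨by omega, fun hle => Or.inl ?_⟩
    intro x hx y hy
    obtain ⟨a, rfl⟩ := hmem x hx
    obtain ⟨b, rfl⟩ := hmem y hy
    rw [Subtype.ext (h3 (by omega) ((hX a).1 hx) ((hX b).1 hy))]

lemma three_le_pairCount_gExt (h : IsFourCutSide G A p q r t) {Z : Set (↥A ⊕ Fin 2)}
    (hZ : Z.Nonempty) (hZ' : Zᶜ.Nonempty) :
    3 ≤ pairCount (GExt G A p q r t) Z Zᶜ ∧ (pairCount (GExt G A p q r t) Z Zᶜ ≤ 3 →
      Z.Subsingleton ∨ Zᶜ.Subsingleton ∨ (IsTwoSeparated G A p q r t ∧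
        ∀ (u : A) (i : Fin 2), (GExt G A p q r t).Adj (Sum.inl u) (Sum.inr i) →
          (Sum.inl u ∈ Z ↔ Sum.inr i ∈ Z))) := by
  by_cases h0 : Sum.inr 0 ∈ Z
  · have := h.three_le_pairCount_gExt_of_notMem (Z := Zᶜ) (fun k => k h0) hZ'
    rw [pairCount_compl, compl_compl] at this
    simp only [Set.mem_compl_iff, not_iff_not] at this
    exact ⟨this.1, fun hle => or_left_comm.1 (this.2 hle)⟩
  · exact h.three_le_pairCount_gExt_of_notMem h0 hZ

lemma edgeConnectedGe_gExt (h : IsFourCutSide G A p q r t) :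
    EdgeConnectedGe (GExt G A p q r t) 3 := fun Z hZ hZ' => by
  rw [ncard_cutEdges]
  exact (h.three_le_pairCount_gExt hZ hZ').1

lemma of_cyclicCut (h : IsFourCutSide G A p q r t) {Z : Set (↥A ⊕ Fin 2)}
    (hZ : CyclicCut (GExt G A p q r t) Z) (hle : (cutEdges (GExt G A p q r t) Z).ncard ≤ 3) :
    IsTwoSeparated G A p q r t ∧
      ∀ (u : A) (i : Fin 2), (GExt G A p q r t).Adj (Sum.inl u) (Sum.inr i) →
        (Sum.inl u ∈ Z ↔ Sum.inr i ∈ Z) := by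
  have h1 := not_subsingleton_of_not_isAcyclic hZ.1
  have h2 := not_subsingleton_of_not_isAcyclic hZ.2
  rw [ncard_cutEdges] at hle
  exact (((h.three_le_pairCount_gExt (Set.not_subsingleton_iff.1 h1).nonempty
    (Set.not_subsingleton_iff.1 h2).nonempty).2 hle).resolve_left h1).resolve_left h2

lemma notMem_cutEdges_gExt (h : IsFourCutSide G A p q r t) {Z : Set (↥A ⊕ Fin 2)}
    (hZ : CyclicCut (GExt G A p q r t) Z) (hle : (cutEdges (GExt G A p q r t) Z).ncard ≤ 3)
    (u : A) (i : Fin 2) : s(Sum.inl u, Sum.inr i) ∉ cutEdges (GExt G A p q r t) Z := by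
  rintro ⟨hadj, x, y, hxy, hx, hy⟩
  have key := (h.of_cyclicCut hZ hle).2 u i hadj
  rcases Sym2.eq_iff.1 hxy with ⟨rfl, rfl⟩ | ⟨rfl, rfl⟩
  · exact hy (key.1 hx)
  · exact hy (key.2 hx)

lemma isTwoSeparated_of_not_cyclicallyEdgeConnected (h : IsFourCutSide G A p q r t)
    (hC : ¬CyclicallyEdgeConnected (GExt G A p q r t) 4) : IsTwoSeparated G A p q r t := by
  simp only [CyclicallyEdgeConnected, not_forall, not_le] at hC
  obtain ⟨Z, hZ, hlt⟩ := hC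
  exact (h.of_cyclicCut hZ (by omega)).1

end IsFourCutSide

lemma pairCount_singleton [Fintype V] (G : SimpleGraph V) (a b : V) :
    pairCount G {a} {b} = truthVal (G.Adj a b) := by
  rw [pairCount_eq_sum_truthVal,
    Finset.sum_eq_single a (fun x _ hx => by simp [hx, truthVal]) (by simp),
    Finset.sum_eq_single b (fun x _ hx => by simp [hx, truthVal]) (by simp)]
  simp

lemma IsFourCutSide.is4Cycle [Fintype V] {G : SimpleGraph V} {A : Set V} {p q r t : V}
    (h : IsFourCutSide G A p q r t) (h₁ : IsTwoSeparated G A p q r t)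
    (h₂ : IsTwoSeparated G A p r q t) : Is4Cycle G A := by
  obtain ⟨X, hXA, pX, qX, rX, tX, hX⟩ := h₁
  obtain ⟨Y, hYA, pY, rY, qY, tY, hY⟩ := h₂
  obtain ⟨hp, hq, hr, ht⟩ := h.mem
  obtain ⟨P, hP⟩ : ∃ P, P = X ∩ Y := ⟨_, rfl⟩
  obtain ⟨Q, hQ⟩ : ∃ Q, Q = X \ Y := ⟨_, rfl⟩
  obtain ⟨R, hR⟩ : ∃ R, R = Y \ X := ⟨_, rfl⟩
  obtain ⟨T, hT⟩ : ∃ T, T = A \ (X ∪ Y) := ⟨_, rfl⟩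
  have hPQ : Disjoint P Q := by rw [Set.disjoint_left]; grind
  have hRT : Disjoint R T := by rw [Set.disjoint_left]; grind
  have hPR : Disjoint P R := by rw [Set.disjoint_left]; grind
  have hQT : Disjoint Q T := by rw [Set.disjoint_left]; grind
  have hQR : Disjoint Q R := by rw [Set.disjoint_left]; grind
  have hPT : Disjoint P T := by rw [Set.disjoint_left]; grind
  rw [show X = P ∪ Q by grind, show A \ (P ∪ Q) = R ∪ T by grind, pairCount_union_left G hPQ,
    pairCount_union_right G hRT, pairCount_union_right G hRT] at hX
  rw [show Y = P ∪ R by grind, show A \ (P ∪ R) = Q ∪ T by grind, pairCount_union_left G hPR,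
    pairCount_union_right G hQT, pairCount_union_right G hQT, pairCount_comm G R Q] at hY
  have tv : truthVal True = 1 := truthVal_of_pos trivial
  have tv' : truthVal False = 0 := truthVal_of_neg not_false
  have bound : ∀ S S₁ S₂ S₃ : Set V, S ∪ S₁ ∪ S₂ ∪ S₃ = A → Disjoint S S₁ → Disjoint S S₂ →
      Disjoint S S₃ → Disjoint S₁ S₂ → Disjoint S₁ S₃ → Disjoint S₂ S₃ → ∀ s ∈ S,
      truthVal (p ∈ S) + truthVal (q ∈ S) + truthVal (r ∈ S) + truthVal (t ∈ S) = 1 →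
      2 ≤ pairCount G S S₁ + pairCount G S S₂ + pairCount G S S₃ ∧
      (pairCount G S S₁ + pairCount G S S₂ + pairCount G S S₃ ≤ 2 → S = {s}) := by
    intro S S₁ S₂ S₃ hA h01 h02 h03 h12 h13 h23 s hs h1
    have hSA : S ⊆ A := by grind
    have e : A \ S = S₁ ∪ S₂ ∪ S₃ := by
      rw [Set.disjoint_left] at h01 h02 h03
      grind
    have b := h.three_le S hSA ⟨s, hs⟩
    have b' := h.subsingleton S hSA ⟨s, hs⟩
    rw [e, pairCount_union_right G (Set.disjoint_union_left.2 ⟨h13, h23⟩),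
      pairCount_union_right G h12, h1] at b b'
    exact ⟨by omega, fun hle => (b' (by omega)).eq_singleton_of_mem hs⟩
  have bP := bound P Q R T (by grind) hPQ hPR hPT hQR hQT hRT p (by grind)
    (by simp [hP, pX, pY, qY, rX, tX, tv, tv'])
  have bQ := bound Q P T R (by grind) hPQ.symm hQT hQR hPT hPR hRT.symm q (by grind)
    (by simp [hQ, pY, qX, qY, rX, tX, tv, tv'])
  have bR := bound R P T Q (by grind) hPR.symm hRT hQR.symm hPT hPQ hQT.symm r (by grind)
    (by simp [hR, pX, qX, rX, rY, tY, tv, tv'])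
  have bT := bound T Q R P (by grind) hQT.symm hRT.symm hPT.symm hQR hPQ.symm hPR.symm t (by grind)
    (by simp [hT, pX, qX, rY, tX, tY, ht, tv, tv'])
  rw [pairCount_comm G Q P] at bQ
  rw [pairCount_comm G R P, pairCount_comm G R Q] at bR
  rw [pairCount_comm G T P, pairCount_comm G T Q, pairCount_comm G T R] at bT
  have eP : P = {p} := bP.2 (by omega)
  have eQ : Q = {q} := bQ.2 (by omega)
  have eR : R = {r} := bR.2 (by omega)
  have eT : T = {t} := bT.2 (by omega)
  have hA : A = {p, q, t, r} := by grind
  simp only [eP, eQ, eR, eT, pairCount_singleton] at hX hY bP bQ bR bT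
  have le_one : ∀ C : Prop, truthVal C ≤ 1 := fun C => by
    by_cases hC : C <;> simp [hC, tv, tv']
  have of_one : ∀ C : Prop, truthVal C = 1 → C := fun C hC => by
    by_contra hC'
    simp [truthVal_of_neg hC'] at hC
  have of_zero : ∀ C : Prop, truthVal C = 0 → ¬C := fun C hC hC' => by
    simp [truthVal_of_pos hC'] at hC
  have l1 := le_one (G.Adj p q)
  have l2 := le_one (G.Adj p r)
  have l3 := le_one (G.Adj q t)
  have l4 := le_one (G.Adj r t)
  exact ⟨p, q, t, r, h.pq, h.pt, h.pr, h.qt, h.qr, h.rt.symm, hA, of_one _ (by omega),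
    of_one _ (by omega), (of_one _ (by omega) : G.Adj r t).symm,
    (of_one _ (by omega) : G.Adj p r).symm, of_zero _ (by omega), of_zero _ (by omega)⟩

lemma isFourCutSide_of_cutEdges_eq [Fintype V] {G : SimpleGraph V} (hG : CubicGraph G)
    (hC : CyclicallyEdgeConnected G 4) {A : Set V} (hcyc : CyclicCut G A)
    {p q r t p' q' r' t' : V} (hpq : p ≠ q) (hpr : p ≠ r) (hpt : p ≠ t) (hqr : q ≠ r)
    (hqt : q ≠ t) (hrt : r ≠ t) (hA : p ∈ A ∧ q ∈ A ∧ r ∈ A ∧ t ∈ A)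
    (hA' : p' ∉ A ∧ q' ∉ A ∧ r' ∉ A ∧ t' ∉ A)
    (hcut : cutEdges G A = {s(p, p'), s(q, q'), s(r, r'), s(t, t')}) :
    IsFourCutSide G A p q r t := by
  have hB := not_subsingleton_of_not_isAcyclic hcyc.2
  have key : ∀ X ⊆ A, pairCount G X Xᶜ = pairCount G X (A \ X) +
      (truthVal (p ∈ X) + truthVal (q ∈ X) + truthVal (r ∈ X) + truthVal (t ∈ X)) := by
    intro X hX
    rw [← pairCount_compl_of_cutEdges_eq hpq hpr hpt hqr hqt hrt hA hA' hcut hX,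
      ← pairCount_union_right G (by rw [Set.disjoint_left]; grind)]
    congr 1
    grind
  have bound : ∀ X ⊆ A, X.Nonempty →
      3 ≤ pairCount G X Xᶜ ∧ (pairCount G X Xᶜ ≤ 3 → X.Subsingleton) := by
    intro X hX hne
    have hXB : Aᶜ ⊆ Xᶜ := Set.compl_subset_compl.2 hX
    have := three_le_pairCount_compl hG hC hne ⟨p', hXB hA'.1⟩
    exact ⟨this.1, fun hle => (this.2 hle).resolve_right fun h => hB (h.anti hXB)⟩
  exact ⟨hpq, hpr, hpt, hqr, hqt, hrt, hA, fun X hX hne => key X hX ▸ (bound X hX hne).1,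
    fun X hX hne => key X hX ▸ (bound X hX hne).2⟩

/-- Lemma on the graphs `G_{(1i)}`.  Let `E(A, Aᶜ)` be a cyclic 4-edge-cut of a
cyclically 4-edge-connected cubic graph `G`, with cut edges `s(vᵢ, wᵢ)`, `vᵢ ∈ A`.
Then all three graphs `G_{(12)}, G_{(13)}, G_{(14)}` are 3-edge-connected and in each
of them no edge joining some `vᵢ` to a new vertex lies in a cyclic 3-edge-cut;
moreover if `G[A]` is not a 4-cycle, then at least two of the three graphs are
cyclically 4-edge-connected. -/
theorem cyclic_four_cut_extension_graphs
    (G : SimpleGraph V) (hcubic : CubicGraph G)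
    (hC4 : CyclicallyEdgeConnected G 4)
    (A : Set V) (hcyc : CyclicCut G A)
    (v₁ v₂ v₃ v₄ w₁ w₂ w₃ w₄ : V)
    (hv12 : v₁ ≠ v₂) (hv13 : v₁ ≠ v₃) (hv14 : v₁ ≠ v₄)
    (hv23 : v₂ ≠ v₃) (hv24 : v₂ ≠ v₄) (hv34 : v₃ ≠ v₄)
    (hvA : v₁ ∈ A ∧ v₂ ∈ A ∧ v₃ ∈ A ∧ v₄ ∈ A)
    (hwA : w₁ ∉ A ∧ w₂ ∉ A ∧ w₃ ∉ A ∧ w₄ ∉ A)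
    (hadj : G.Adj v₁ w₁ ∧ G.Adj v₂ w₂ ∧ G.Adj v₃ w₃ ∧ G.Adj v₄ w₄)
    (hcut : cutEdges G A = {s(v₁, w₁), s(v₂, w₂), s(v₃, w₃), s(v₄, w₄)}) :
    (∀ H ∈ [GExt G A v₁ v₂ v₃ v₄, GExt G A v₁ v₃ v₂ v₄, GExt G A v₁ v₄ v₂ v₃],
      EdgeConnectedGe H 3 ∧
      ∀ X : Set (↥A ⊕ Fin 2), CyclicCut H X → (cutEdges H X).ncard = 3 →
        ∀ (u : ↥A) (i : Fin 2), s(Sum.inl u, Sum.inr i) ∉ cutEdges H X) ∧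
    (¬Is4Cycle G A →
      (CyclicallyEdgeConnected (GExt G A v₁ v₂ v₃ v₄) 4 ∧
        CyclicallyEdgeConnected (GExt G A v₁ v₃ v₂ v₄) 4) ∨
      (CyclicallyEdgeConnected (GExt G A v₁ v₂ v₃ v₄) 4 ∧
        CyclicallyEdgeConnected (GExt G A v₁ v₄ v₂ v₃) 4) ∨
      (CyclicallyEdgeConnected (GExt G A v₁ v₃ v₂ v₄) 4 ∧
        CyclicallyEdgeConnected (GExt G A v₁ v₄ v₂ v₃) 4)) := by
  have : Finite V := finite_of_cyclicallyEdgeConnected hcubic (by norm_num) hC4 hcyc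
  have : Fintype V := Fintype.ofFinite V
  have h2 : IsFourCutSide G A v₁ v₂ v₃ v₄ :=
    isFourCutSide_of_cutEdges_eq hcubic hC4 hcyc hv12 hv13 hv14 hv23 hv24 hv34 hvA hwA hcut
  have h3 : IsFourCutSide G A v₁ v₃ v₂ v₄ := h2.swap_middle
  have h4 : IsFourCutSide G A v₁ v₄ v₂ v₃ := h2.swap_last.swap_middle
  refine ⟨fun H hH => ?_, fun hcycle => ?_⟩
  · simp only [List.mem_cons, List.not_mem_nil, or_false] at hH
    rcases hH with rfl | rfl | rfl
    · exact ⟨h2.edgeConnectedGe_gExt, fun X hX hc => h2.notMem_cutEdges_gExt hX hc.le⟩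
    · exact ⟨h3.edgeConnectedGe_gExt, fun X hX hc => h3.notMem_cutEdges_gExt hX hc.le⟩
    · exact ⟨h4.edgeConnectedGe_gExt, fun X hX hc => h4.notMem_cutEdges_gExt hX hc.le⟩
  · have s2 := h2.isTwoSeparated_of_not_cyclicallyEdgeConnected
    have s3 := h3.isTwoSeparated_of_not_cyclicallyEdgeConnected
    have s4 := h4.isTwoSeparated_of_not_cyclicallyEdgeConnected
    have n23 := fun k2 k3 => hcycle (h2.is4Cycle k2 k3)
    have n24 := fun k2 k4 => hcycle (h2.swap_last.is4Cycle (IsTwoSeparated.swap_last k2) k4)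
    have n34 := fun k3 k4 => hcycle (h3.swap_last.is4Cycle (IsTwoSeparated.swap_last k3)
      (IsTwoSeparated.swap_last k4))
    tauto
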